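/- arXiv:1612.00072 — 15 statements merged into one kernel-verified Lean document; each statement's English description precedes it below -/
import Mathlib

section
/- Let E be a nonempty set and let A, B : (E → ℝ) → ℝ be isotonic linear functionals. Let p, q : E → ℝ be non-negative functions and let f, g : E → ℝ be similarly ordered functions, i.e. (f(x)−f(y))(g(x)−g(y)) ≥ 0 for all x, y ∈ E. Then A(p·f·g)·B(q) + A(p)·B(q·f·g) ≥ A(p·f)·B(q·g) + A(p·g)·B(q·f). If instead f and g are oppositely ordered, i.e. (f(x)−f(y))(g(x)−g(y)) ≤ 0 for all x, y ∈ E, then the reversed inequality holds. -/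
theorem map_four_term_combination {E : Type*} {L : (E → ℝ) → ℝ}
    (hL : ∀ (f g : E → ℝ) (a b : ℝ), L (fun t => a * f t + b * g t) = a * L f + b * L g)
    (u v w z : E → ℝ) (a b c d : ℝ) :
    L (fun t => a * u t + b * v t + (c * w t + d * z t)) =
      a * L u + b * L v + (c * L w + d * L z) := by
  have h := hL (fun t => a * u t + b * v t) (fun t => c * w t + d * z t) 1 1
  simpa only [one_mul, hL] using h

/-- The Chebyshev-type inequality for two isotonic linear functionals, with a factor `s` whose sign
distinguishes similarly ordered from oppositely ordered functions. -/
theorem isotonic_chebyshev_of_signed_order {E : Type*} {A B : (E → ℝ) → ℝ}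
    (hAlin : ∀ (f g : E → ℝ) (a b : ℝ), A (fun t => a * f t + b * g t) = a * A f + b * A g)
    (hAmono : ∀ f : E → ℝ, (∀ t, (0:ℝ) ≤ f t) → 0 ≤ A f)
    (hBlin : ∀ (f g : E → ℝ) (a b : ℝ), B (fun t => a * f t + b * g t) = a * B f + b * B g)
    (hBmono : ∀ f : E → ℝ, (∀ t, (0:ℝ) ≤ f t) → 0 ≤ B f)
    {p q f g : E → ℝ} (hp : ∀ t, 0 ≤ p t) (hq : ∀ t, 0 ≤ q t) (s : ℝ)
    (h : ∀ x y, 0 ≤ s * ((f x - f y) * (g x - g y))) :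
    0 ≤ s * (A (fun t => p t * f t * g t) * B q + A p * B (fun t => q t * f t * g t) -
      (A (fun t => p t * f t) * B (fun t => q t * g t) +
        A (fun t => p t * g t) * B (fun t => q t * f t))) := by
  have hB : ∀ x, 0 ≤ s * (f x * g x) * B q + s * B (fun t => q t * f t * g t) +
      (-(s * f x) * B (fun t => q t * g t) + -(s * g x) * B (fun t => q t * f t)) := by
    intro x
    rw [← map_four_term_combination hBlin]
    refine hBmono _ fun y => ?_
    linear_combination mul_nonneg (hq y) (h x y)
  have hA : 0 ≤ (s * B q) * A (fun t => p t * f t * g t) +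
      (s * B (fun t => q t * f t * g t)) * A p +
      (-(s * B (fun t => q t * g t)) * A (fun t => p t * f t) +
        -(s * B (fun t => q t * f t)) * A (fun t => p t * g t)) := by
    rw [← map_four_term_combination hAlin]
    refine hAmono _ fun x => ?_
    linear_combination mul_nonneg (hp x) (hB x)
  linear_combination hA

theorem stmt_0 {E : Type*} [Nonempty E]
    (A B : (E → ℝ) → ℝ)
    (hAlin : ∀ (f g : E → ℝ) (a b : ℝ), A (fun t => a * f t + b * g t) = a * A f + b * A g)
    (hAmono : ∀ f : E → ℝ, (∀ t, (0:ℝ) ≤ f t) → 0 ≤ A f)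
    (hBlin : ∀ (f g : E → ℝ) (a b : ℝ), B (fun t => a * f t + b * g t) = a * B f + b * B g)
    (hBmono : ∀ f : E → ℝ, (∀ t, (0:ℝ) ≤ f t) → 0 ≤ B f)
    (p q f g : E → ℝ) (hp : ∀ t, 0 ≤ p t) (hq : ∀ t, 0 ≤ q t) :
    ((∀ x y, 0 ≤ (f x - f y) * (g x - g y)) →
      A (fun t => p t * f t * g t) * B q + A p * B (fun t => q t * f t * g t) ≥
        A (fun t => p t * f t) * B (fun t => q t * g t) +
          A (fun t => p t * g t) * B (fun t => q t * f t)) ∧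
    ((∀ x y, (f x - f y) * (g x - g y) ≤ 0) →
      A (fun t => p t * f t * g t) * B q + A p * B (fun t => q t * f t * g t) ≤
        A (fun t => p t * f t) * B (fun t => q t * g t) +
          A (fun t => p t * g t) * B (fun t => q t * f t)) := by
  have key := isotonic_chebyshev_of_signed_order (f := f) (g := g) hAlin hAmono hBlin hBmono hp hq
  refine ⟨fun h => ?_, fun h => ?_⟩
  · linarith [key 1 fun x y => by linarith [h x y]]
  · linarith [key (-1) fun x y => by linarith [h x y]]
end

section
/- Let E be a nonempty set and let A, B : (E → ℝ) → ℝ be isotonic linear functionals. Let p, q : E → ℝ be non-negative functions, let M₁, M₂ ∈ ℝ, and let f, g, h₁, h₂ : E → ℝ be functions such that |f(x)−f(y)| ≤ M₁·|h₁(x)−h₁(y)| and |g(x)−g(y)| ≤ M₂·|h₂(x)−h₂(y)| for all x, y ∈ E. If h₁ and h₂ are similarly ordered, or h₁ and h₂ are oppositely ordered, then |T(A,B,p,q,f,g)| ≤ M₁·M₂·T(A,B,p,q,h₁,h₂) in the similarly ordered case, and |T(A,B,p,q,f,g)| ≤ −M₁·M₂·T(A,B,p,q,h₁,h₂) in the oppositely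 ordered case. -/
/-- The Chebyshev difference of two linear functionals with weights `p` and `q`. -/
def chebyshevDiff {E : Type*} (A B : (E → ℝ) → ℝ) (p q f g : E → ℝ) : ℝ :=
  B q * A (fun t => p t * f t * g t) + A p * B (fun t => q t * f t * g t)
    - A (fun t => p t * f t) * B (fun t => q t * g t)
    - A (fun t => p t * g t) * B (fun t => q t * f t)

theorem exists_linearMap_coe_eq {E : Type*} {A : (E → ℝ) → ℝ}
    (hA : ∀ (f g : E → ℝ) (a b : ℝ), A (fun t => a * f t + b * g t) = a * A f + b * A g) :
    ∃ L : (E → ℝ) →ₗ[ℝ] ℝ, ⇑L = A := by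
  refine ⟨{ toFun := A, map_add' := fun f g => ?_, map_smul' := fun a f => ?_ }, rfl⟩
  · simpa [Pi.add_def] using hA f g 1 1
  · simpa [Pi.smul_def] using hA f f a 0

theorem chebyshevDiff_eq_iterated {E : Type*} (A B : (E → ℝ) →ₗ[ℝ] ℝ) (p q f g : E → ℝ) :
    chebyshevDiff A B p q f g =
      A (fun x => B (fun y => p x * q y * ((f x - f y) * (g x - g y)))) := by
  have inner_eq (x : E) : B (fun y => p x * q y * ((f x - f y) * (g x - g y))) =
      p x * f x * g x * B q + p x * B (fun y => q y * f y * g y)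
        - p x * f x * B (fun y => q y * g y) - p x * g x * B (fun y => q y * f y) := by
    have h : (fun y => p x * q y * ((f x - f y) * (g x - g y))) =
        (p x * f x * g x) • q + p x • (fun y => q y * f y * g y)
          - (p x * f x) • (fun y => q y * g y) - (p x * g x) • (fun y => q y * f y) := by
      ext y
      simp only [Pi.add_apply, Pi.sub_apply, Pi.smul_apply, smul_eq_mul]
      ring
    rw [h]
    simp only [map_add, map_sub, map_smul, smul_eq_mul]
  have outer_eq : (fun x => B (fun y => p x * q y * ((f x - f y) * (g x - g y)))) =
      B q • (fun x => p x * f x * g x) + B (fun y => q y * f y * g y) • p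
        - B (fun y => q y * g y) • (fun x => p x * f x)
        - B (fun y => q y * f y) • (fun x => p x * g x) := by
    ext x
    simp only [inner_eq, Pi.add_apply, Pi.sub_apply, Pi.smul_apply, smul_eq_mul]
    ring
  rw [outer_eq, chebyshevDiff]
  simp only [map_add, map_sub, map_smul, smul_eq_mul]
  ring

theorem LinearMap.monotone_of_nonneg {E : Type*} (A : (E → ℝ) →ₗ[ℝ] ℝ)
    (hA : ∀ f : E → ℝ, (∀ t, 0 ≤ f t) → 0 ≤ A f) : Monotone A := by
  intro f g hfg
  rw [← sub_nonneg, ← map_sub]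
  exact hA _ fun t => sub_nonneg.2 (hfg t)

theorem chebyshevDiff_le {E : Type*} {A B : (E → ℝ) →ₗ[ℝ] ℝ} (hA : Monotone A)
    (hB : Monotone B) {p q f g h₁ h₂ : E → ℝ} (hp : ∀ t, 0 ≤ p t) (hq : ∀ t, 0 ≤ q t)
    (h : ∀ x y, (f x - f y) * (g x - g y) ≤ (h₁ x - h₁ y) * (h₂ x - h₂ y)) :
    chebyshevDiff A B p q f g ≤ chebyshevDiff A B p q h₁ h₂ := by
  rw [chebyshevDiff_eq_iterated, chebyshevDiff_eq_iterated]
  exact hA fun x => hB fun y =>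
    mul_le_mul_of_nonneg_left (h x y) (mul_nonneg (hp x) (hq y))

theorem chebyshevDiff_const_mul {E : Type*} (A B : (E → ℝ) →ₗ[ℝ] ℝ) (p q f g : E → ℝ) (c : ℝ) :
    chebyshevDiff A B p q (fun t => c * f t) g = c * chebyshevDiff A B p q f g := by
  have smul_left (L : (E → ℝ) →ₗ[ℝ] ℝ) (w : E → ℝ) :
      L (fun t => w t * (c * f t)) = c * L (fun t => w t * f t) := by
    rw [← smul_eq_mul, ← map_smul]
    congr 1
    ext t
    simp only [Pi.smul_apply, smul_eq_mul]
    ring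
  have smul_mid (L : (E → ℝ) →ₗ[ℝ] ℝ) (w : E → ℝ) :
      L (fun t => w t * (c * f t) * g t) = c * L (fun t => w t * f t * g t) := by
    rw [← smul_eq_mul, ← map_smul]
    congr 1
    ext t
    simp only [Pi.smul_apply, smul_eq_mul]
    ring
  simp only [chebyshevDiff, smul_left, smul_mid]
  ring

theorem abs_chebyshevDiff_le {E : Type*} {A B : (E → ℝ) →ₗ[ℝ] ℝ} (hA : Monotone A)
    (hB : Monotone B) {p q f g h₁ h₂ : E → ℝ} (hp : ∀ t, 0 ≤ p t) (hq : ∀ t, 0 ≤ q t) {c : ℝ}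
    (h : ∀ x y, |(f x - f y) * (g x - g y)| ≤ c * ((h₁ x - h₁ y) * (h₂ x - h₂ y))) :
    |chebyshevDiff A B p q f g| ≤ c * chebyshevDiff A B p q h₁ h₂ := by
  rw [← chebyshevDiff_const_mul, abs_le']
  constructor
  · refine chebyshevDiff_le hA hB hp hq fun x y => ?_
    linarith [h x y, le_abs_self ((f x - f y) * (g x - g y))]
  · rw [← neg_one_mul, ← chebyshevDiff_const_mul]
    refine chebyshevDiff_le hA hB hp hq fun x y => ?_
    linarith [h x y, neg_le_abs ((f x - f y) * (g x - g y))]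


theorem stmt_2 {E : Type*} [Nonempty E]
    (A B : (E → ℝ) → ℝ)
    (hAlin : ∀ (f g : E → ℝ) (a b : ℝ), A (fun t => a * f t + b * g t) = a * A f + b * A g)
    (hAmono : ∀ f : E → ℝ, (∀ t, (0:ℝ) ≤ f t) → 0 ≤ A f)
    (hBlin : ∀ (f g : E → ℝ) (a b : ℝ), B (fun t => a * f t + b * g t) = a * B f + b * B g)
    (hBmono : ∀ f : E → ℝ, (∀ t, (0:ℝ) ≤ f t) → 0 ≤ B f)
    (p q : E → ℝ) (hp : ∀ t, 0 ≤ p t) (hq : ∀ t, 0 ≤ q t)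
    (M₁ M₂ : ℝ) (f g h₁ h₂ : E → ℝ)
    (hf : ∀ x y, |f x - f y| ≤ M₁ * |h₁ x - h₁ y|)
    (hg : ∀ x y, |g x - g y| ≤ M₂ * |h₂ x - h₂ y|) :
    ((∀ x y, 0 ≤ (h₁ x - h₁ y) * (h₂ x - h₂ y)) →
      |(B q * A (fun t => p t * f t * g t) + A p * B (fun t => q t * f t * g t) - A (fun t => p t * f t) * B (fun t => q t * g t) - A (fun t => p t * g t) * B (fun t => q t * f t))| ≤ M₁ * M₂ * (B q * A (fun t => p t * h₁ t * h₂ t) + A p * B (fun t => q t * h₁ t * h₂ t) - A (fun t => p t * h₁ t) * B (fun t => q t * h₂ t) - A (fun t => p t * h₂ t) * B (fun t => q t * h₁ t))) ∧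
    ((∀ x y, (h₁ x - h₁ y) * (h₂ x - h₂ y) ≤ 0) →
      |(B q * A (fun t => p t * f t * g t) + A p * B (fun t => q t * f t * g t) - A (fun t => p t * f t) * B (fun t => q t * g t) - A (fun t => p t * g t) * B (fun t => q t * f t))| ≤ -(M₁ * M₂ * (B q * A (fun t => p t * h₁ t * h₂ t) + A p * B (fun t => q t * h₁ t * h₂ t) - A (fun t => p t * h₁ t) * B (fun t => q t * h₂ t) - A (fun t => p t * h₂ t) * B (fun t => q t * h₁ t)))) := by
  obtain ⟨A, rfl⟩ := exists_linearMap_coe_eq hAlin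
  obtain ⟨B, rfl⟩ := exists_linearMap_coe_eq hBlin
  have hA := A.monotone_of_nonneg hAmono
  have hB := B.monotone_of_nonneg hBmono
  have hfg (x y : E) : |(f x - f y) * (g x - g y)| ≤
      M₁ * M₂ * |(h₁ x - h₁ y) * (h₂ x - h₂ y)| := by
    rw [abs_mul, abs_mul, mul_mul_mul_comm]
    exact mul_le_mul (hf x y) (hg x y) (abs_nonneg _) ((abs_nonneg _).trans (hf x y))
  refine ⟨fun h => ?_, fun h => ?_⟩
  · exact abs_chebyshevDiff_le hA hB hp hq fun x y => by
      simpa only [abs_of_nonneg (h x y)] using hfg x y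
  · rw [← neg_mul]
    exact abs_chebyshevDiff_le hA hB hp hq fun x y => by
      simpa only [abs_of_nonpos (h x y), mul_neg, neg_mul] using hfg x y
end

section
/- Let E be a nonempty set and let A, B : (E → ℝ) → ℝ be isotonic linear functionals. Let p, q : E → ℝ be non-negative functions, let M ≥ 0 be a real number, and let f, g : E → ℝ be functions with |f(x)−f(y)| ≤ M·|g(x)−g(y)| for all x, y ∈ E. Then |A(p·f·g)·B(q) + A(p)·B(q·f·g) − A(p·f)·B(q·g) − A(p·g)·B(q·f)| ≤ M·( A(p·g²)·B(q) − 2·A(p·g)·B(q·g) + A(p)·B(q·g²) ). -/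
/-- A functional respecting binary linear combinations respects combinations of four functions. -/
theorem map_linear_combination_four {E : Type*} {A : (E → ℝ) → ℝ}
    (hA : ∀ (f g : E → ℝ) (a b : ℝ), A (fun t => a * f t + b * g t) = a * A f + b * A g)
    (f g h k : E → ℝ) (a b c d : ℝ) :
    A (fun t => a * f t + b * g t + c * h t + d * k t) =
      a * A f + b * A g + c * A h + d * A k := by
  have key := hA (fun t => a * f t + b * g t) (fun t => c * h t + d * k t) 1 1
  simp only [hA, one_mul] at key
  simpa only [add_assoc] using key

/-- Chebyshev's inequality for a pair of isotonic linear functionals and synchronous functions. -/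
theorem chebyshev_nonneg_of_synchronous {E : Type*} {A B : (E → ℝ) → ℝ}
    (hAlin : ∀ (f g : E → ℝ) (a b : ℝ), A (fun t => a * f t + b * g t) = a * A f + b * A g)
    (hAmono : ∀ f : E → ℝ, (∀ t, (0 : ℝ) ≤ f t) → 0 ≤ A f)
    (hBlin : ∀ (f g : E → ℝ) (a b : ℝ), B (fun t => a * f t + b * g t) = a * B f + b * B g)
    (hBmono : ∀ f : E → ℝ, (∀ t, (0 : ℝ) ≤ f t) → 0 ≤ B f)
    {p q : E → ℝ} (hp : ∀ t, 0 ≤ p t) (hq : ∀ t, 0 ≤ q t) {h g : E → ℝ}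
    (hsync : ∀ x y, 0 ≤ (h x - h y) * (g x - g y)) :
    0 ≤ A (fun t => p t * h t * g t) * B q + A p * B (fun t => q t * h t * g t) -
      A (fun t => p t * h t) * B (fun t => q t * g t) -
      A (fun t => p t * g t) * B (fun t => q t * h t) := by
  have inner_nonneg (y : E) : 0 ≤ A (fun t => p t * h t * g t) - g y * A (fun t => p t * h t) -
      h y * A (fun t => p t * g t) + h y * g y * A p := by
    have hpos := hAmono _ fun x => mul_nonneg (hp x) (hsync x y)
    have expand := map_linear_combination_four hAlin (fun t => p t * h t * g t)
      (fun t => p t * h t) (fun t => p t * g t) p 1 (-g y) (-h y) (h y * g y)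
    have integrand_eq : (fun x => p x * ((h x - h y) * (g x - g y))) =
        fun t => 1 * (p t * h t * g t) + -g y * (p t * h t) + -h y * (p t * g t) +
          h y * g y * p t := by
      funext t; ring
    rw [integrand_eq, expand] at hpos
    linarith
  have hpos := hBmono _ fun y => mul_nonneg (hq y) (inner_nonneg y)
  have expand := map_linear_combination_four hBlin q (fun t => q t * g t) (fun t => q t * h t)
    (fun t => q t * h t * g t) (A (fun t => p t * h t * g t)) (-A (fun t => p t * h t))
    (-A (fun t => p t * g t)) (A p)
  refine (hpos.trans_eq (congrArg B ?_)).trans_eq (expand.trans ?_)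
  · funext t; ring
  · ring

/-- If `s * f` grows no faster than `M * g`, then the Chebyshev functional of `s * f` and `g` is
bounded by `M` times that of `g` with itself. -/
theorem mul_chebyshev_le {E : Type*} {A B : (E → ℝ) → ℝ}
    (hAlin : ∀ (f g : E → ℝ) (a b : ℝ), A (fun t => a * f t + b * g t) = a * A f + b * A g)
    (hAmono : ∀ f : E → ℝ, (∀ t, (0 : ℝ) ≤ f t) → 0 ≤ A f)
    (hBlin : ∀ (f g : E → ℝ) (a b : ℝ), B (fun t => a * f t + b * g t) = a * B f + b * B g)
    (hBmono : ∀ f : E → ℝ, (∀ t, (0 : ℝ) ≤ f t) → 0 ≤ B f)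
    {p q : E → ℝ} (hp : ∀ t, 0 ≤ p t) (hq : ∀ t, 0 ≤ q t) {f g : E → ℝ} {M s : ℝ}
    (hsfg : ∀ x y, s * ((f x - f y) * (g x - g y)) ≤ M * (g x - g y) ^ 2) :
    s * (A (fun t => p t * f t * g t) * B q + A p * B (fun t => q t * f t * g t) -
      A (fun t => p t * f t) * B (fun t => q t * g t) -
      A (fun t => p t * g t) * B (fun t => q t * f t)) ≤
    M * (A (fun t => p t * g t ^ 2) * B q - 2 * A (fun t => p t * g t) * B (fun t => q t * g t) +
      A p * B (fun t => q t * g t ^ 2)) := by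
  have hpos := chebyshev_nonneg_of_synchronous hAlin hAmono hBlin hBmono hp hq
    (h := fun t => M * g t - s * f t) (g := g) fun x y => by linarith [hsfg x y]
  have prod_eq (w : E → ℝ) : (fun t => w t * (M * g t - s * f t) * g t) =
      fun t => M * (w t * g t ^ 2) + -s * (w t * f t * g t) := by
    funext t; ring
  have weight_eq (w : E → ℝ) : (fun t => w t * (M * g t - s * f t)) =
      fun t => M * (w t * g t) + -s * (w t * f t) := by
    funext t; ring
  simp only [prod_eq, weight_eq, hAlin, hBlin] at hpos
  linarith


theorem stmt_3 {E : Type*} [Nonempty E]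
    (A B : (E → ℝ) → ℝ)
    (hAlin : ∀ (f g : E → ℝ) (a b : ℝ), A (fun t => a * f t + b * g t) = a * A f + b * A g)
    (hAmono : ∀ f : E → ℝ, (∀ t, (0:ℝ) ≤ f t) → 0 ≤ A f)
    (hBlin : ∀ (f g : E → ℝ) (a b : ℝ), B (fun t => a * f t + b * g t) = a * B f + b * B g)
    (hBmono : ∀ f : E → ℝ, (∀ t, (0:ℝ) ≤ f t) → 0 ≤ B f)
    (p q : E → ℝ) (hp : ∀ t, 0 ≤ p t) (hq : ∀ t, 0 ≤ q t)
    (M : ℝ) (hM : 0 ≤ M) (f g : E → ℝ)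
    (hfg : ∀ x y, |f x - f y| ≤ M * |g x - g y|) :
    |A (fun t => p t * f t * g t) * B q + A p * B (fun t => q t * f t * g t) -
      A (fun t => p t * f t) * B (fun t => q t * g t) -
      A (fun t => p t * g t) * B (fun t => q t * f t)| ≤
    M * (A (fun t => p t * g t ^ 2) * B q - 2 * A (fun t => p t * g t) * B (fun t => q t * g t) +
      A p * B (fun t => q t * g t ^ 2)) := by
  have abs_bound (x y : E) : |(f x - f y) * (g x - g y)| ≤ M * (g x - g y) ^ 2 := by
    rw [abs_mul, ← sq_abs (g x - g y), sq, ← mul_assoc]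
    exact mul_le_mul_of_nonneg_right (hfg x y) (abs_nonneg _)
  have upper := mul_chebyshev_le hAlin hAmono hBlin hBmono hp hq
      (f := f) (g := g) (M := M) (s := 1) fun x y => by
      linarith [(abs_le.mp (abs_bound x y)).2]
  have lower := mul_chebyshev_le hAlin hAmono hBlin hBmono hp hq
      (f := f) (g := g) (M := M) (s := -1) fun x y => by
      linarith [(abs_le.mp (abs_bound x y)).1]
  exact abs_le.mpr ⟨by linarith, by linarith⟩
end

section
/- Let A, B : (ℝ → ℝ) → ℝ be isotonic linear functionals. Let p, q : ℝ → ℝ be non-negative functions, let H₁, H₂ > 0, let r, s ∈ (0,1], and let f, g : ℝ → ℝ satisfy |f(x)−f(y)| ≤ H₁·|x−y|^r and |g(x)−g(y)| ≤ H₂·|x−y|^s for all x, y ∈ ℝ. Then |T(A,B,p,q,f,g)| ≤ H₁·H₂·B(y ↦ A(x ↦ p(x)·q(y)·|x−y|^{r+s})). -/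
/-- A linear functional on real functions respects linear combinations of four functions. -/
theorem map_linearCombination_four {L : (ℝ → ℝ) → ℝ}
    (hL : ∀ (f g : ℝ → ℝ) (a b : ℝ), L (fun t => a * f t + b * g t) = a * L f + b * L g)
    (f₁ f₂ f₃ f₄ : ℝ → ℝ) (a b c d : ℝ) :
    L (fun t => a * f₁ t + b * f₂ t + c * f₃ t + d * f₄ t) =
      a * L f₁ + b * L f₂ + c * L f₃ + d * L f₄ := by
  have h := hL (fun t => a * f₁ t + b * f₂ t) (fun t => c * f₃ t + d * f₄ t) 1 1
  simp only [one_mul, hL] at h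
  simpa only [add_assoc] using h

/-- An isotonic linear functional preserves pointwise bounds on absolute values. -/
theorem abs_map_le_of_abs_le {L : (ℝ → ℝ) → ℝ}
    (hL : ∀ (f g : ℝ → ℝ) (a b : ℝ), L (fun t => a * f t + b * g t) = a * L f + b * L g)
    (hpos : ∀ f : ℝ → ℝ, (∀ t, (0:ℝ) ≤ f t) → 0 ≤ L f)
    {φ ψ : ℝ → ℝ} {c : ℝ} (h : ∀ t, |φ t| ≤ c * ψ t) : |L φ| ≤ c * L ψ := by
  have h₁ := hpos (fun t => c * ψ t + (-1) * φ t) fun t => by linarith [(abs_le.1 (h t)).2]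
  have h₂ := hpos (fun t => c * ψ t + 1 * φ t) fun t => by linarith [(abs_le.1 (h t)).1]
  rw [hL] at h₁ h₂
  exact abs_le.2 ⟨by linarith, by linarith⟩


theorem stmt_4
    (A B : (ℝ → ℝ) → ℝ)
    (hAlin : ∀ (f g : ℝ → ℝ) (a b : ℝ), A (fun t => a * f t + b * g t) = a * A f + b * A g)
    (hAmono : ∀ f : ℝ → ℝ, (∀ t, (0:ℝ) ≤ f t) → 0 ≤ A f)
    (hBlin : ∀ (f g : ℝ → ℝ) (a b : ℝ), B (fun t => a * f t + b * g t) = a * B f + b * B g)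
    (hBmono : ∀ f : ℝ → ℝ, (∀ t, (0:ℝ) ≤ f t) → 0 ≤ B f)
    (p q : ℝ → ℝ) (hp : ∀ t, 0 ≤ p t) (hq : ∀ t, 0 ≤ q t)
    (H₁ H₂ : ℝ) (hH₁ : 0 < H₁) (hH₂ : 0 < H₂)
    (r s : ℝ) (hr : r ∈ Set.Ioc (0:ℝ) 1) (hs : s ∈ Set.Ioc (0:ℝ) 1)
    (f g : ℝ → ℝ)
    (hf : ∀ x y, |f x - f y| ≤ H₁ * |x - y| ^ r)
    (hg : ∀ x y, |g x - g y| ≤ H₂ * |x - y| ^ s) :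
    |B q * A (fun t => p t * f t * g t) + A p * B (fun t => q t * f t * g t) -
      A (fun t => p t * f t) * B (fun t => q t * g t) -
      A (fun t => p t * g t) * B (fun t => q t * f t)| ≤
    H₁ * H₂ * B (fun y => A (fun x => p x * q y * |x - y| ^ (r + s))) := by
  have key : ∀ x y, |p x * q y * ((f x - f y) * (g x - g y))| ≤
      (H₁ * H₂) * (p x * q y * |x - y| ^ (r + s)) := fun x y => by
    have hpq := mul_nonneg (hp x) (hq y)
    rw [Real.rpow_add_of_nonneg (abs_nonneg _) hr.1.le hs.1.le, abs_mul, abs_of_nonneg hpq, abs_mul]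
    calc p x * q y * (|f x - f y| * |g x - g y|)
        ≤ p x * q y * ((H₁ * |x - y| ^ r) * (H₂ * |x - y| ^ s)) := by
          gcongr
          exacts [hf x y, hg x y]
      _ = _ := by ring
  have hA : ∀ y, A (fun x => p x * q y * ((f x - f y) * (g x - g y))) =
      A (fun t => p t * f t * g t) * q y + A p * (q y * f y * g y) +
        (-A (fun t => p t * f t)) * (q y * g y) + (-A (fun t => p t * g t)) * (q y * f y) := by
    intro y
    have h := map_linearCombination_four hAlin (fun t => p t * f t * g t) p
      (fun t => p t * f t) (fun t => p t * g t) (q y) (q y * f y * g y) (-(q y * g y))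
      (-(q y * f y))
    convert h using 1
    · congr 1
      ext x
      ring
    · ring
  have hB := abs_map_le_of_abs_le hBlin hBmono
    fun y => abs_map_le_of_abs_le hAlin hAmono fun x => key x y
  simp only [hA] at hB
  rw [map_linearCombination_four hBlin q (fun t => q t * f t * g t) (fun t => q t * g t)
    (fun t => q t * f t)] at hB
  convert hB using 2
  ring
end

section
/- Let E be a nonempty set and let A, B : (E → ℝ) → ℝ be isotonic linear functionals. Let p, q : E → ℝ be non-negative functions and let f, φ₁, φ₂ : E → ℝ be functions such that φ₁(t) ≤ f(t) ≤ φ₂(t) for all t ∈ E. Then A(p·φ₂)·B(q·f) + A(p·f)·B(q·φ₁) ≥ A(p·φ₂)·B(q·φ₁) + A(p·f)·B(q·f). -/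
theorem isotonic_linear_functional_mul_le {E : Type*} (A : (E → ℝ) → ℝ)
    (hlin : ∀ (f g : E → ℝ) (a b : ℝ), A (fun t => a * f t + b * g t) = a * A f + b * A g)
    (hmono : ∀ f : E → ℝ, (∀ t, (0:ℝ) ≤ f t) → 0 ≤ A f)
    {p g h : E → ℝ} (hp : ∀ t, 0 ≤ p t) (hgh : ∀ t, g t ≤ h t) :
    A (fun t => p t * g t) ≤ A (fun t => p t * h t) := by
  have hnonneg := hmono (fun t => 1 * (p t * h t) + (-1) * (p t * g t)) fun t => by
    linarith [mul_le_mul_of_nonneg_left (hgh t) (hp t)]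
  rw [hlin (fun t => p t * h t) (fun t => p t * g t)] at hnonneg
  linarith

theorem stmt_5 {E : Type*} [Nonempty E]
    (A B : (E → ℝ) → ℝ)
    (hAlin : ∀ (f g : E → ℝ) (a b : ℝ), A (fun t => a * f t + b * g t) = a * A f + b * A g)
    (hAmono : ∀ f : E → ℝ, (∀ t, (0:ℝ) ≤ f t) → 0 ≤ A f)
    (hBlin : ∀ (f g : E → ℝ) (a b : ℝ), B (fun t => a * f t + b * g t) = a * B f + b * B g)
    (hBmono : ∀ f : E → ℝ, (∀ t, (0:ℝ) ≤ f t) → 0 ≤ B f)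
    (p q : E → ℝ) (hp : ∀ t, 0 ≤ p t) (hq : ∀ t, 0 ≤ q t)
    (f φ₁ φ₂ : E → ℝ) (hf : ∀ t, φ₁ t ≤ f t ∧ f t ≤ φ₂ t) :
    A (fun t => p t * φ₂ t) * B (fun t => q t * f t) +
      A (fun t => p t * f t) * B (fun t => q t * φ₁ t) ≥
    A (fun t => p t * φ₂ t) * B (fun t => q t * φ₁ t) +
      A (fun t => p t * f t) * B (fun t => q t * f t) := by
  have hA := isotonic_linear_functional_mul_le A hAlin hAmono hp fun t => (hf t).2
  have hB := isotonic_linear_functional_mul_le B hBlin hBmono hq fun t => (hf t).1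
  linarith [mul_nonneg (sub_nonneg.2 hA) (sub_nonneg.2 hB)]
end

section
/- Let E be a nonempty set and let A, B : (E → ℝ) → ℝ be isotonic linear functionals. Let p, q : E → ℝ be non-negative functions, let m, M ∈ ℝ, and let f : E → ℝ satisfy m ≤ f(t) ≤ M for all t ∈ E. Then M·A(p)·B(q·f) + m·A(p·f)·B(q) ≥ M·m·A(p)·B(q) + A(p·f)·B(q·f). -/
theorem stmt_6 {E : Type*} [Nonempty E]
    (A B : (E → ℝ) → ℝ)
    (hAlin : ∀ (f g : E → ℝ) (a b : ℝ), A (fun t => a * f t + b * g t) = a * A f + b * A g)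
    (hAmono : ∀ f : E → ℝ, (∀ t, (0:ℝ) ≤ f t) → 0 ≤ A f)
    (hBlin : ∀ (f g : E → ℝ) (a b : ℝ), B (fun t => a * f t + b * g t) = a * B f + b * B g)
    (hBmono : ∀ f : E → ℝ, (∀ t, (0:ℝ) ≤ f t) → 0 ≤ B f)
    (p q : E → ℝ) (hp : ∀ t, 0 ≤ p t) (hq : ∀ t, 0 ≤ q t)
    (m M : ℝ) (f : E → ℝ) (hf : ∀ t, m ≤ f t ∧ f t ≤ M) :
    M * A p * B (fun t => q t * f t) + m * A (fun t => p t * f t) * B q ≥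
      M * m * A p * B q + A (fun t => p t * f t) * B (fun t => q t * f t) := by
  have hA : 0 ≤ M * A p + -1 * A (fun t => p t * f t) := by
    rw [← hAlin]
    exact hAmono _ fun t => by nlinarith [mul_nonneg (hp t) (sub_nonneg.2 (hf t).2)]
  have hB : 0 ≤ 1 * B (fun t => q t * f t) + -m * B q := by
    rw [← hBlin]
    exact hBmono _ fun t => by nlinarith [mul_nonneg (hq t) (sub_nonneg.2 (hf t).1)]
  linarith [mul_nonneg hA hB]
end

section
/- Let E be a nonempty set and let A, B : (E → ℝ) → ℝ be isotonic linear functionals. Let p, q : E → ℝ be non-negative functions, let M > 0, and let φ, f : E → ℝ satisfy |f(t)−φ(t)| ≤ M for all t ∈ E. Then A(p·φ)·B(q·f) + A(p·f)·B(q·φ) + M·A(p)·B(q·f) + M·A(p·φ)·B(q) + M²·A(p)·B(q) ≥ A(p·φ)·B(q·φ) + M·A(p)·B(q·φ) + M·A(p·f)·B(q) + A(p·f)·B(q·f). -/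
theorem isotonic_linear_mul_le {E : Type*} (L : (E → ℝ) → ℝ)
    (hlin : ∀ (f g : E → ℝ) (a b : ℝ), L (fun t => a * f t + b * g t) = a * L f + b * L g)
    (hmono : ∀ f : E → ℝ, (∀ t, (0:ℝ) ≤ f t) → 0 ≤ L f)
    (w : E → ℝ) (hw : ∀ t, 0 ≤ w t) (M : ℝ) (g h : E → ℝ) (hgh : ∀ t, g t ≤ h t + M) :
    L (fun t => w t * g t) ≤ M * L w + L (fun t => w t * h t) := by
  have hpos := hmono (fun t => 1 * (M * w t + 1 * (w t * h t)) + (-1) * (w t * g t))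
    fun t => by nlinarith [mul_nonneg (hw t) (sub_nonneg.2 (hgh t))]
  rw [hlin (fun t => M * w t + 1 * (w t * h t)) (fun t => w t * g t),
    hlin w (fun t => w t * h t)] at hpos
  linarith

theorem stmt_7 {E : Type*} [Nonempty E]
    (A B : (E → ℝ) → ℝ)
    (hAlin : ∀ (f g : E → ℝ) (a b : ℝ), A (fun t => a * f t + b * g t) = a * A f + b * A g)
    (hAmono : ∀ f : E → ℝ, (∀ t, (0:ℝ) ≤ f t) → 0 ≤ A f)
    (hBlin : ∀ (f g : E → ℝ) (a b : ℝ), B (fun t => a * f t + b * g t) = a * B f + b * B g)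
    (hBmono : ∀ f : E → ℝ, (∀ t, (0:ℝ) ≤ f t) → 0 ≤ B f)
    (p q : E → ℝ) (hp : ∀ t, 0 ≤ p t) (hq : ∀ t, 0 ≤ q t)
    (M : ℝ) (hM : 0 < M) (φ f : E → ℝ) (hf : ∀ t, |f t - φ t| ≤ M) :
    A (fun t => p t * φ t) * B (fun t => q t * f t) +
      A (fun t => p t * f t) * B (fun t => q t * φ t) +
      M * A p * B (fun t => q t * f t) +
      M * A (fun t => p t * φ t) * B q + M ^ 2 * A p * B q ≥
    A (fun t => p t * φ t) * B (fun t => q t * φ t) +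
      M * A p * B (fun t => q t * φ t) +
      M * A (fun t => p t * f t) * B q +
      A (fun t => p t * f t) * B (fun t => q t * f t) := by
  have hA := isotonic_linear_mul_le A hAlin hAmono p hp M f φ
    fun t => by linarith [(abs_le.1 (hf t)).2]
  have hB := isotonic_linear_mul_le B hBlin hBmono q hq M φ f
    fun t => by linarith [(abs_le.1 (hf t)).1]
  linarith [mul_nonneg (sub_nonneg.2 hA) (sub_nonneg.2 hB)]
end

section
/- Let E be a nonempty set and let A, B : (E → ℝ) → ℝ be isotonic linear functionals. Let p, q : E → ℝ be non-negative functions and let φ₁, φ₂, ψ₁, ψ₂, f, g : E → ℝ satisfy φ₁(t) ≤ f(t) ≤ φ₂(t) and ψ₁(t) ≤ g(t) ≤ ψ₂(t) for all t ∈ E. Then the following four inequalities hold: (1) A(p·φ₁)·B(q·ψ₁) + A(p·f)·B(q·g) ≥ A(p·φ₁)·B(q·g) + A(p·f)·B(q·ψ₁); (2) A(p·φ₁)·B(q·ψ₂) + A(p·f)·B(q·g) ≤ A(p·φ₁)·B(q·g) + A(p·f)·B(q·ψ₂); (3) A(p·φ₂)·B(q·ψ₁) + A(p·f)·B(q·g)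 ≤ A(p·φ₂)·B(q·g) + A(p·f)·B(q·ψ₁); (4) A(p·φ₂)·B(q·ψ₂) + A(p·f)·B(q·g) ≥ A(p·φ₂)·B(q·g) + A(p·f)·B(q·ψ₂). -/
/-- An isotonic linear functional is monotone after multiplication by a non-negative weight. -/
theorem isotonic_mul_le_mul {E : Type*} (A : (E → ℝ) → ℝ)
    (hlin : ∀ (f g : E → ℝ) (a b : ℝ), A (fun t => a * f t + b * g t) = a * A f + b * A g)
    (hmono : ∀ f : E → ℝ, (∀ t, (0 : ℝ) ≤ f t) → 0 ≤ A f)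
    {p u v : E → ℝ} (hp : ∀ t, 0 ≤ p t) (huv : ∀ t, u t ≤ v t) :
    A (fun t => p t * u t) ≤ A (fun t => p t * v t) := by
  have h := hmono (fun t => 1 * (p t * v t) + (-1) * (p t * u t)) fun t => by
    linarith [mul_le_mul_of_nonneg_left (huv t) (hp t)]
  rw [hlin (fun t => p t * v t) (fun t => p t * u t)] at h
  linarith

theorem stmt_8 {E : Type*} [Nonempty E]
    (A B : (E → ℝ) → ℝ)
    (hAlin : ∀ (f g : E → ℝ) (a b : ℝ), A (fun t => a * f t + b * g t) = a * A f + b * A g)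
    (hAmono : ∀ f : E → ℝ, (∀ t, (0:ℝ) ≤ f t) → 0 ≤ A f)
    (hBlin : ∀ (f g : E → ℝ) (a b : ℝ), B (fun t => a * f t + b * g t) = a * B f + b * B g)
    (hBmono : ∀ f : E → ℝ, (∀ t, (0:ℝ) ≤ f t) → 0 ≤ B f)
    (p q : E → ℝ) (hp : ∀ t, 0 ≤ p t) (hq : ∀ t, 0 ≤ q t)
    (φ₁ φ₂ ψ₁ ψ₂ f g : E → ℝ)
    (hf : ∀ t, φ₁ t ≤ f t ∧ f t ≤ φ₂ t)
    (hg : ∀ t, ψ₁ t ≤ g t ∧ g t ≤ ψ₂ t) :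
    (A (fun t => p t * φ₁ t) * B (fun t => q t * ψ₁ t) + A (fun t => p t * f t) * B (fun t => q t * g t) ≥
      A (fun t => p t * φ₁ t) * B (fun t => q t * g t) + A (fun t => p t * f t) * B (fun t => q t * ψ₁ t)) ∧
    (A (fun t => p t * φ₁ t) * B (fun t => q t * ψ₂ t) + A (fun t => p t * f t) * B (fun t => q t * g t) ≤
      A (fun t => p t * φ₁ t) * B (fun t => q t * g t) + A (fun t => p t * f t) * B (fun t => q t * ψ₂ t)) ∧
    (A (fun t => p t * φ₂ t) * B (fun t => q t * ψ₁ t) + A (fun t => p t * f t) * B (fun t => q t * g t) ≤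
      A (fun t => p t * φ₂ t) * B (fun t => q t * g t) + A (fun t => p t * f t) * B (fun t => q t * ψ₁ t)) ∧
    (A (fun t => p t * φ₂ t) * B (fun t => q t * ψ₂ t) + A (fun t => p t * f t) * B (fun t => q t * g t) ≥
      A (fun t => p t * φ₂ t) * B (fun t => q t * g t) + A (fun t => p t * f t) * B (fun t => q t * ψ₂ t)) := by
  have hA₁ := isotonic_mul_le_mul A hAlin hAmono hp fun t => (hf t).1
  have hA₂ := isotonic_mul_le_mul A hAlin hAmono hp fun t => (hf t).2
  have hB₁ := isotonic_mul_le_mul B hBlin hBmono hq fun t => (hg t).1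
  have hB₂ := isotonic_mul_le_mul B hBlin hBmono hq fun t => (hg t).2
  exact ⟨mul_add_mul_le_mul_add_mul hA₁ hB₁,
    by linarith [mul_add_mul_le_mul_add_mul hA₁ hB₂],
    by linarith [mul_add_mul_le_mul_add_mul hA₂ hB₁],
    by linarith [mul_add_mul_le_mul_add_mul hA₂ hB₂]⟩
end

section
/- Let E be a nonempty set and let A, B : (E → ℝ) → ℝ be isotonic linear functionals. Let p, q : E → ℝ be non-negative functions, let m, M, n, N ∈ ℝ, and let f, g : E → ℝ satisfy m ≤ f(t) ≤ M and n ≤ g(t) ≤ N for all t ∈ E. Then: (1) m·n·A(p)·B(q) + A(p·f)·B(q·g) ≥ m·A(p)·B(q·g) + n·A(p·f)·B(q); (2) m·N·A(p)·B(q) + A(p·f)·B(q·g) ≤ m·A(p)·B(q·g) + N·A(p·f)·B(q); (3) M·n·A(p)·B(q) + A(p·f)·B(q·g) ≤ M·A(p)·B(q·g) + n·A(p·f)·B(q); (4) M·N·A(p)·B(q) + A(p·f)·B(q·g) ≥ M·A(p)·B(q·g) + N·A(p·f)·B(q). -/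
theorem weighted_apply_mem_Icc_of_isotonic {E : Type*} {A : (E → ℝ) → ℝ}
    (hlin : ∀ (f g : E → ℝ) (a b : ℝ), A (fun t => a * f t + b * g t) = a * A f + b * A g)
    (hmono : ∀ f : E → ℝ, (∀ t, (0 : ℝ) ≤ f t) → 0 ≤ A f)
    {p f : E → ℝ} {m M : ℝ} (hp : ∀ t, 0 ≤ p t) (hf : ∀ t, m ≤ f t ∧ f t ≤ M) :
    A (fun t => p t * f t) ∈ Set.Icc (m * A p) (M * A p) := by
  have lower := hmono (fun t => 1 * (p t * f t) + (-m) * p t) fun t => by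
    nlinarith [mul_nonneg (hp t) (sub_nonneg.2 (hf t).1)]
  have upper := hmono (fun t => M * p t + (-1) * (p t * f t)) fun t => by
    nlinarith [mul_nonneg (hp t) (sub_nonneg.2 (hf t).2)]
  rw [hlin (fun t => p t * f t) p] at lower
  rw [hlin p (fun t => p t * f t)] at upper
  constructor <;> linarith

theorem stmt_9 {E : Type*} [Nonempty E]
    (A B : (E → ℝ) → ℝ)
    (hAlin : ∀ (f g : E → ℝ) (a b : ℝ), A (fun t => a * f t + b * g t) = a * A f + b * A g)
    (hAmono : ∀ f : E → ℝ, (∀ t, (0:ℝ) ≤ f t) → 0 ≤ A f)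
    (hBlin : ∀ (f g : E → ℝ) (a b : ℝ), B (fun t => a * f t + b * g t) = a * B f + b * B g)
    (hBmono : ∀ f : E → ℝ, (∀ t, (0:ℝ) ≤ f t) → 0 ≤ B f)
    (p q : E → ℝ) (hp : ∀ t, 0 ≤ p t) (hq : ∀ t, 0 ≤ q t)
    (m M n N : ℝ) (f g : E → ℝ)
    (hf : ∀ t, m ≤ f t ∧ f t ≤ M)
    (hg : ∀ t, n ≤ g t ∧ g t ≤ N) :
    (m * n * A p * B q + A (fun t => p t * f t) * B (fun t => q t * g t) ≥
      m * A p * B (fun t => q t * g t) + n * A (fun t => p t * f t) * B q) ∧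
    (m * N * A p * B q + A (fun t => p t * f t) * B (fun t => q t * g t) ≤
      m * A p * B (fun t => q t * g t) + N * A (fun t => p t * f t) * B q) ∧
    (M * n * A p * B q + A (fun t => p t * f t) * B (fun t => q t * g t) ≤
      M * A p * B (fun t => q t * g t) + n * A (fun t => p t * f t) * B q) ∧
    (M * N * A p * B q + A (fun t => p t * f t) * B (fun t => q t * g t) ≥
      M * A p * B (fun t => q t * g t) + N * A (fun t => p t * f t) * B q) := by
  obtain ⟨hmA, hAM⟩ := weighted_apply_mem_Icc_of_isotonic hAlin hAmono hp hf
  obtain ⟨hnB, hBN⟩ := weighted_apply_mem_Icc_of_isotonic hBlin hBmono hq hg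
  rw [← sub_nonneg] at hmA hAM hnB hBN
  refine ⟨?_, ?_, ?_, ?_⟩
  · linarith [mul_nonneg hmA hnB]
  · linarith [mul_nonneg hmA hBN]
  · linarith [mul_nonneg hAM hnB]
  · linarith [mul_nonneg hAM hBN]
end

section
/- Let E be a nonempty set and let A, B : (E → ℝ) → ℝ be isotonic linear functionals. Let p, q : E → ℝ be non-negative functions, let θ₁, θ₂ > 0 with 1/θ₁ + 1/θ₂ = 1, and let f, φ₁, φ₂ : E → ℝ satisfy φ₁(t) ≤ f(t) ≤ φ₂(t) for all t ∈ E. Then (1/θ₁)·B(q)·A(p·(φ₂−f)^{θ₁}) + (1/θ₂)·A(p)·B(q·(f−φ₁)^{θ₂}) + A(p·φ₂)·B(q·φ₁) + A(p·f)·B(q·f) ≥ A(p·φ₂)·B(q·f) + A(p·f)·B(q·φ₁). -/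
/-- An isotonic linear functional is monotone. -/
lemma isotonic_linear_mono {E : Type*} {A : (E → ℝ) → ℝ}
    (hlin : ∀ (f g : E → ℝ) (a b : ℝ), A (fun t => a * f t + b * g t) = a * A f + b * A g)
    (hpos : ∀ f : E → ℝ, (∀ t, (0:ℝ) ≤ f t) → 0 ≤ A f)
    {f g : E → ℝ} (h : ∀ t, f t ≤ g t) : A f ≤ A g := by
  have h0 := hpos (fun t => 1 * g t + (-1) * f t) fun t => by linarith [h t]
  rw [hlin] at h0
  linarith

/-- Two isotonic linear functionals, applied one in each variable, preserve an inequality between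
sums of products of functions of separate variables. -/
lemma isotonic_linear_mul_le_s10 {E F : Type*} {A : (E → ℝ) → ℝ} {B : (F → ℝ) → ℝ}
    (hAlin : ∀ (f g : E → ℝ) (a b : ℝ), A (fun t => a * f t + b * g t) = a * A f + b * A g)
    (hApos : ∀ f : E → ℝ, (∀ t, (0:ℝ) ≤ f t) → 0 ≤ A f)
    (hBlin : ∀ (f g : F → ℝ) (a b : ℝ), B (fun t => a * f t + b * g t) = a * B f + b * B g)
    (hBpos : ∀ f : F → ℝ, (∀ t, (0:ℝ) ≤ f t) → 0 ≤ B f)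
    {g₀ g₁ g₂ : E → ℝ} {h₀ h₁ h₂ : F → ℝ} {a b : ℝ}
    (h : ∀ t s, g₀ t * h₀ s ≤ a * (g₁ t * h₁ s) + b * (g₂ t * h₂ s)) :
    A g₀ * B h₀ ≤ a * (A g₁ * B h₁) + b * (A g₂ * B h₂) := by
  have hA : ∀ s, A g₀ * h₀ s + 0 * h₀ s ≤ (a * A g₁) * h₁ s + (b * A g₂) * h₂ s := fun s => by
    have hs := isotonic_linear_mono hAlin hApos
      (f := fun t => h₀ s * g₀ t + 0 * g₀ t)
      (g := fun t => (a * h₁ s) * g₁ t + (b * h₂ s) * g₂ t)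
      fun t => by linarith [h t s]
    rw [hAlin, hAlin] at hs
    linarith
  have hB := isotonic_linear_mono hBlin hBpos hA
  rw [hBlin, hBlin] at hB
  linarith

theorem stmt_10 {E : Type*} [Nonempty E]
    (A B : (E → ℝ) → ℝ)
    (hAlin : ∀ (f g : E → ℝ) (a b : ℝ), A (fun t => a * f t + b * g t) = a * A f + b * A g)
    (hAmono : ∀ f : E → ℝ, (∀ t, (0:ℝ) ≤ f t) → 0 ≤ A f)
    (hBlin : ∀ (f g : E → ℝ) (a b : ℝ), B (fun t => a * f t + b * g t) = a * B f + b * B g)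
    (hBmono : ∀ f : E → ℝ, (∀ t, (0:ℝ) ≤ f t) → 0 ≤ B f)
    (p q : E → ℝ) (hp : ∀ t, 0 ≤ p t) (hq : ∀ t, 0 ≤ q t)
    (θ₁ θ₂ : ℝ) (hθ₁ : 0 < θ₁) (hθ₂ : 0 < θ₂) (hθ : 1 / θ₁ + 1 / θ₂ = 1)
    (f φ₁ φ₂ : E → ℝ) (hf : ∀ t, φ₁ t ≤ f t ∧ f t ≤ φ₂ t) :
    1 / θ₁ * B q * A (fun t => p t * (φ₂ t - f t) ^ θ₁) +
      1 / θ₂ * A p * B (fun t => q t * (f t - φ₁ t) ^ θ₂) +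
      A (fun t => p t * φ₂ t) * B (fun t => q t * φ₁ t) +
      A (fun t => p t * f t) * B (fun t => q t * f t) ≥
    A (fun t => p t * φ₂ t) * B (fun t => q t * f t) +
      A (fun t => p t * f t) * B (fun t => q t * φ₁ t) := by
  have hAsub : A (fun t => p t * (φ₂ t - f t)) = A (fun t => p t * φ₂ t) - A (fun t => p t * f t) := by
    have h := hAlin (fun t => p t * φ₂ t) (fun t => p t * f t) 1 (-1)
    rw [show (fun t => p t * (φ₂ t - f t)) =
      fun t => 1 * (p t * φ₂ t) + (-1) * (p t * f t) by ext t; ring, h]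
    ring
  have hBsub : B (fun t => q t * (f t - φ₁ t)) = B (fun t => q t * f t) - B (fun t => q t * φ₁ t) := by
    have h := hBlin (fun t => q t * f t) (fun t => q t * φ₁ t) 1 (-1)
    rw [show (fun t => q t * (f t - φ₁ t)) =
      fun t => 1 * (q t * f t) + (-1) * (q t * φ₁ t) by ext t; ring, h]
    ring
  have hconj : θ₁.HolderConjugate θ₂ :=
    ⟨by simpa [one_div] using hθ, hθ₁, hθ₂⟩
  have key := isotonic_linear_mul_le_s10 hAlin hAmono hBlin hBmono
    (g₀ := fun t => p t * (φ₂ t - f t)) (h₀ := fun t => q t * (f t - φ₁ t))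
    (g₁ := fun t => p t * (φ₂ t - f t) ^ θ₁) (h₁ := q)
    (g₂ := p) (h₂ := fun t => q t * (f t - φ₁ t) ^ θ₂) (a := 1 / θ₁) (b := 1 / θ₂)
    fun t s => by
      have young := Real.young_inequality_of_nonneg
        (sub_nonneg.2 (hf t).2) (sub_nonneg.2 (hf s).1) hconj
      have := mul_le_mul_of_nonneg_left young (mul_nonneg (hp t) (hq s))
      calc _ = p t * q s * ((φ₂ t - f t) * (f s - φ₁ s)) := by ring
        _ ≤ _ := this
        _ = _ := by ring
  rw [hAsub, hBsub] at key
  linarith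
end

section
/- Let E be a nonempty set and let A, B : (E → ℝ) → ℝ be isotonic linear functionals. Let p, q : E → ℝ be non-negative functions, let m, M ∈ ℝ, and let f : E → ℝ satisfy m ≤ f(t) ≤ M for all t ∈ E. Then (M+m)²·A(p)·B(q) + A(p·f²)·B(q) + 2·A(p·f)·B(q·f) + A(p)·B(q·f²) ≥ 2·(M+m)·( A(p)·B(q·f) + A(p·f)·B(q) ). -/
/-- A functional that respects two-term linear combinations respects the combination of `w`,
`w * f` and `w * f ^ 2` given by a quadratic polynomial in `f`. -/
theorem map_weighted_quadratic {E : Type*} {L : (E → ℝ) → ℝ}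
    (hL : ∀ (f g : E → ℝ) (a b : ℝ), L (fun t => a * f t + b * g t) = a * L f + b * L g)
    (w f : E → ℝ) (a b c : ℝ) :
    L (fun t => w t * (a + b * f t + c * f t ^ 2)) =
      a * L w + b * L (fun t => w t * f t) + c * L (fun t => w t * f t ^ 2) := by
  have h := hL (fun t => a * w t + b * (w t * f t)) (fun t => w t * f t ^ 2) 1 c
  rw [hL w (fun t => w t * f t) a b, one_mul] at h
  rw [← h]
  congr 1
  funext t
  ring


theorem stmt_11 {E : Type*} [Nonempty E]
    (A B : (E → ℝ) → ℝ)
    (hAlin : ∀ (f g : E → ℝ) (a b : ℝ), A (fun t => a * f t + b * g t) = a * A f + b * A g)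
    (hAmono : ∀ f : E → ℝ, (∀ t, (0:ℝ) ≤ f t) → 0 ≤ A f)
    (hBlin : ∀ (f g : E → ℝ) (a b : ℝ), B (fun t => a * f t + b * g t) = a * B f + b * B g)
    (hBmono : ∀ f : E → ℝ, (∀ t, (0:ℝ) ≤ f t) → 0 ≤ B f)
    (p q : E → ℝ) (hp : ∀ t, 0 ≤ p t) (hq : ∀ t, 0 ≤ q t)
    (m M : ℝ) (f : E → ℝ) (hf : ∀ t, m ≤ f t ∧ f t ≤ M) :
    (M + m) ^ 2 * A p * B q + A (fun t => p t * f t ^ 2) * B q +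
      2 * A (fun t => p t * f t) * B (fun t => q t * f t) +
      A p * B (fun t => q t * f t ^ 2) ≥
    2 * (M + m) * (A p * B (fun t => q t * f t) + A (fun t => p t * f t) * B q) := by
  have hB (c : ℝ) : 0 ≤ c ^ 2 * B q + -(2 * c) * B (fun t => q t * f t) +
      1 * B (fun t => q t * f t ^ 2) := by
    rw [← map_weighted_quadratic hBlin]
    refine hBmono _ fun t => mul_nonneg (hq t) ?_
    nlinarith [sq_nonneg (c - f t)]
  set b₀ := B q
  set b₁ := B (fun t => q t * f t)
  set b₂ := B (fun t => q t * f t ^ 2)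
  have hA : 0 ≤ A (fun s => p s * (((M + m) ^ 2 * b₀ - 2 * (M + m) * b₁ + b₂) +
      (2 * b₁ - 2 * (M + m) * b₀) * f s + b₀ * f s ^ 2)) := by
    refine hAmono _ fun s => mul_nonneg (hp s) ?_
    linarith [hB (M + m - f s)]
  rw [map_weighted_quadratic hAlin] at hA
  linarith
end

section
/- Let E be a nonempty set and let A, B : (E → ℝ) → ℝ be isotonic linear functionals. Let p, q : E → ℝ be non-negative functions, let θ₁, θ₂ > 0 with 1/θ₁ + 1/θ₂ = 1, and let φ₁, φ₂, ψ₁, ψ₂, f, g : E → ℝ satisfy φ₁(t) ≤ f(t) ≤ φ₂(t) and ψ₁(t) ≤ g(t) ≤ ψ₂(t) for all t ∈ E. Then the following four inequalities hold: (1) (1/θ₁)·A(p·(φ₂−f)^{θ₁})·B(q) + (1/θ₂)·A(p)·B(q·(ψ₂−g)^{θ₂}) ≥ A(p·(φ₂−f))·B(q·(ψ₂−g)); (2) (1/θ₁)·A(p·(φ₂−f)^{θ₁})·B(q) + (1/θ₂)·A(p)·B(q·(g−ψ₁)^{θ₂}) ≥ A(p·(φ₂−f))·B(q·(g−ψ₁));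 (3) (1/θ₁)·A(p·(f−φ₁)^{θ₁})·B(q) + (1/θ₂)·A(p)·B(q·(ψ₂−g)^{θ₂}) ≥ A(p·(f−φ₁))·B(q·(ψ₂−g)); (4) (1/θ₁)·A(p·(f−φ₁)^{θ₁})·B(q) + (1/θ₂)·A(p)·B(q·(g−ψ₁)^{θ₂}) ≥ A(p·(f−φ₁))·B(q·(g−ψ₁)). -/
theorem isotonic_linear_le_of_le_combination {E : Type*} {A : (E → ℝ) → ℝ}
    (hlin : ∀ (f g : E → ℝ) (a b : ℝ), A (fun t => a * f t + b * g t) = a * A f + b * A g)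
    (hmono : ∀ f : E → ℝ, (∀ t, (0:ℝ) ≤ f t) → 0 ≤ A f)
    {F G H : E → ℝ} {a b : ℝ} (h : ∀ t, F t ≤ a * G t + b * H t) :
    A F ≤ a * A G + b * A H := by
  have key := hmono (fun t => 1 * (a * G t + b * H t) + (-1) * F t)
    (fun t => by linarith [h t])
  rw [hlin (fun t => a * G t + b * H t) F 1 (-1), hlin G H a b] at key
  linarith

theorem isotonic_linear_young {E : Type*} {A B : (E → ℝ) → ℝ}
    (hAlin : ∀ (f g : E → ℝ) (a b : ℝ), A (fun t => a * f t + b * g t) = a * A f + b * A g)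
    (hAmono : ∀ f : E → ℝ, (∀ t, (0:ℝ) ≤ f t) → 0 ≤ A f)
    (hBlin : ∀ (f g : E → ℝ) (a b : ℝ), B (fun t => a * f t + b * g t) = a * B f + b * B g)
    (hBmono : ∀ f : E → ℝ, (∀ t, (0:ℝ) ≤ f t) → 0 ≤ B f)
    {p q : E → ℝ} (hp : ∀ t, 0 ≤ p t) (hq : ∀ t, 0 ≤ q t)
    {r s : ℝ} (hrs : r.HolderConjugate s)
    {u v : E → ℝ} (hu : ∀ t, 0 ≤ u t) (hv : ∀ t, 0 ≤ v t) :
    A (fun t => p t * u t) * B (fun t => q t * v t) ≤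
      1 / r * A (fun t => p t * u t ^ r) * B q +
        1 / s * A p * B (fun t => q t * v t ^ s) := by
  have hA (y : E) : v y * A (fun t => p t * u t) ≤
      1 / r * A (fun t => p t * u t ^ r) + v y ^ s / s * A p := by
    have hscale := hAlin (fun t => p t * u t) p (v y) 0
    rw [zero_mul, add_zero] at hscale
    rw [← hscale]
    refine isotonic_linear_le_of_le_combination hAlin hAmono fun t => ?_
    have := mul_le_mul_of_nonneg_left
      (Real.young_inequality_of_nonneg (hu t) (hv y) hrs) (hp t)
    calc v y * (p t * u t) + 0 * p t = p t * (u t * v y) := by ring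
      _ ≤ p t * (u t ^ r / r + v y ^ s / s) := this
      _ = 1 / r * (p t * u t ^ r) + v y ^ s / s * p t := by ring
  have hscale := hBlin (fun t => q t * v t) q (A (fun t => p t * u t)) 0
  rw [zero_mul, add_zero] at hscale
  rw [← hscale]
  refine isotonic_linear_le_of_le_combination hBlin hBmono fun y => ?_
  have := mul_le_mul_of_nonneg_left (hA y) (hq y)
  calc _ = q y * (v y * A (fun t => p t * u t)) := by ring
    _ ≤ q y * (1 / r * A (fun t => p t * u t ^ r) + v y ^ s / s * A p) := this
    _ = _ := by ring

theorem stmt_12 {E : Type*} [Nonempty E]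
    (A B : (E → ℝ) → ℝ)
    (hAlin : ∀ (f g : E → ℝ) (a b : ℝ), A (fun t => a * f t + b * g t) = a * A f + b * A g)
    (hAmono : ∀ f : E → ℝ, (∀ t, (0:ℝ) ≤ f t) → 0 ≤ A f)
    (hBlin : ∀ (f g : E → ℝ) (a b : ℝ), B (fun t => a * f t + b * g t) = a * B f + b * B g)
    (hBmono : ∀ f : E → ℝ, (∀ t, (0:ℝ) ≤ f t) → 0 ≤ B f)
    (p q : E → ℝ) (hp : ∀ t, 0 ≤ p t) (hq : ∀ t, 0 ≤ q t)
    (θ₁ θ₂ : ℝ) (hθ₁ : 0 < θ₁) (hθ₂ : 0 < θ₂) (hθ : 1 / θ₁ + 1 / θ₂ = 1)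
    (φ₁ φ₂ ψ₁ ψ₂ f g : E → ℝ)
    (hf : ∀ t, φ₁ t ≤ f t ∧ f t ≤ φ₂ t)
    (hg : ∀ t, ψ₁ t ≤ g t ∧ g t ≤ ψ₂ t) :
    (1 / θ₁ * A (fun t => p t * (φ₂ t - f t) ^ θ₁) * B q +
        1 / θ₂ * A p * B (fun t => q t * (ψ₂ t - g t) ^ θ₂) ≥
      A (fun t => p t * (φ₂ t - f t)) * B (fun t => q t * (ψ₂ t - g t))) ∧
    (1 / θ₁ * A (fun t => p t * (φ₂ t - f t) ^ θ₁) * B q +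
        1 / θ₂ * A p * B (fun t => q t * (g t - ψ₁ t) ^ θ₂) ≥
      A (fun t => p t * (φ₂ t - f t)) * B (fun t => q t * (g t - ψ₁ t))) ∧
    (1 / θ₁ * A (fun t => p t * (f t - φ₁ t) ^ θ₁) * B q +
        1 / θ₂ * A p * B (fun t => q t * (ψ₂ t - g t) ^ θ₂) ≥
      A (fun t => p t * (f t - φ₁ t)) * B (fun t => q t * (ψ₂ t - g t))) ∧
    (1 / θ₁ * A (fun t => p t * (f t - φ₁ t) ^ θ₁) * B q +
        1 / θ₂ * A p * B (fun t => q t * (g t - ψ₁ t) ^ θ₂) ≥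
      A (fun t => p t * (f t - φ₁ t)) * B (fun t => q t * (g t - ψ₁ t))) := by
  have hrs : θ₁.HolderConjugate θ₂ := ⟨by simpa using hθ, hθ₁, hθ₂⟩
  have hf₁ t : 0 ≤ f t - φ₁ t := sub_nonneg.2 (hf t).1
  have hf₂ t : 0 ≤ φ₂ t - f t := sub_nonneg.2 (hf t).2
  have hg₁ t : 0 ≤ g t - ψ₁ t := sub_nonneg.2 (hg t).1
  have hg₂ t : 0 ≤ ψ₂ t - g t := sub_nonneg.2 (hg t).2
  exact ⟨isotonic_linear_young hAlin hAmono hBlin hBmono hp hq hrs hf₂ hg₂,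
    isotonic_linear_young hAlin hAmono hBlin hBmono hp hq hrs hf₂ hg₁,
    isotonic_linear_young hAlin hAmono hBlin hBmono hp hq hrs hf₁ hg₂,
    isotonic_linear_young hAlin hAmono hBlin hBmono hp hq hrs hf₁ hg₁⟩
end

section
/- Let E be a nonempty set and let A, B : (E → ℝ) → ℝ be isotonic linear functionals. Let p, q : E → ℝ be non-negative functions, let f, g : E → ℝ be similarly ordered functions, and let h : E → ℝ be a function with h(t) > 0 for all t ∈ E. Then A(p·f·g·h)·B(q) + A(p·f·g)·B(q·h) + A(p·h)·B(q·f·g) + A(p)·B(q·f·g·h) ≥ A(p·f·h)·B(q·g) + A(p·f)·B(q·g·h) + A(p·g·h)·B(q·f) + A(p·g)·B(q·f·h). If f and g are oppositely ordered, then the reversed inequality holds. -/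
/-- If a finite sum of products `a i x * b i y` is nonnegative everywhere, then so is the sum of the
products of the values of two positive linear functionals. -/
theorem sum_mul_nonneg_of_positive {ι E F : Type*} [Fintype ι]
    (L : (E → ℝ) →ₗ[ℝ] ℝ) (M : (F → ℝ) →ₗ[ℝ] ℝ)
    (hL : ∀ u : E → ℝ, (∀ t, 0 ≤ u t) → 0 ≤ L u) (hM : ∀ u : F → ℝ, (∀ t, 0 ≤ u t) → 0 ≤ M u)
    (a : ι → E → ℝ) (b : ι → F → ℝ) (hab : ∀ x y, 0 ≤ ∑ i, a i x * b i y) :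
    0 ≤ ∑ i, L (a i) * M (b i) := by
  have hMx : ∀ x, 0 ≤ ∑ i, a i x * M (b i) := fun x => by
    have := hM (∑ i, a i x • b i) fun y => by simpa using hab x y
    simpa using this
  have := hL (∑ i, M (b i) • a i) fun x => by simpa [mul_comm] using hMx x
  simpa [mul_comm] using this

/-- The linear map underlying a functional that preserves two-term linear combinations. -/
def linearMapOfCombination {E : Type*} (A : (E → ℝ) → ℝ)
    (hA : ∀ (f g : E → ℝ) (a b : ℝ), A (fun t => a * f t + b * g t) = a * A f + b * A g) :
    (E → ℝ) →ₗ[ℝ] ℝ where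
  toFun := A
  map_add' u v := by
    have := hA u v 1 1
    simp only [one_mul] at this
    exact this
  map_smul' c u := by
    have := hA u u c 0
    simp only [zero_mul, add_zero] at this
    exact this

/-- The weighted Chebyshev-type inequality for similarly ordered functions and two positive linear
functionals. -/
theorem chebyshev_of_similarlyOrdered {E : Type*} (L M : (E → ℝ) →ₗ[ℝ] ℝ)
    (hL : ∀ u : E → ℝ, (∀ t, 0 ≤ u t) → 0 ≤ L u) (hM : ∀ u : E → ℝ, (∀ t, 0 ≤ u t) → 0 ≤ M u)
    (p q : E → ℝ) (hp : ∀ t, 0 ≤ p t) (hq : ∀ t, 0 ≤ q t)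
    (f g h : E → ℝ) (hh : ∀ t, 0 ≤ h t) (hfg : ∀ x y, 0 ≤ (f x - f y) * (g x - g y)) :
    L (p * f * h) * M (q * g) + L (p * f) * M (q * g * h) +
        L (p * g * h) * M (q * f) + L (p * g) * M (q * f * h) ≤
      L (p * f * g * h) * M q + L (p * f * g) * M (q * h) +
        L (p * h) * M (q * f * g) + L p * M (q * f * g * h) := by
  have := sum_mul_nonneg_of_positive L M hL hM
    ![p * f * g * h, p * f * g, p * h, p,
      -(p * f * h), -(p * f), -(p * g * h), -(p * g)]
    ![q, q * h, q * f * g, q * f * g * h, q * g, q * g * h, q * f, q * f * h]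
    fun x y => by
      have := mul_nonneg (mul_nonneg (mul_nonneg (hp x) (hq y)) (add_nonneg (hh x) (hh y)))
        (hfg x y)
      simp [Fin.sum_univ_succ]
      linarith
  simp [Fin.sum_univ_succ] at this
  linarith


theorem stmt_13 {E : Type*} [Nonempty E]
    (A B : (E → ℝ) → ℝ)
    (hAlin : ∀ (f g : E → ℝ) (a b : ℝ), A (fun t => a * f t + b * g t) = a * A f + b * A g)
    (hAmono : ∀ f : E → ℝ, (∀ t, (0:ℝ) ≤ f t) → 0 ≤ A f)
    (hBlin : ∀ (f g : E → ℝ) (a b : ℝ), B (fun t => a * f t + b * g t) = a * B f + b * B g)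
    (hBmono : ∀ f : E → ℝ, (∀ t, (0:ℝ) ≤ f t) → 0 ≤ B f)
    (p q : E → ℝ) (hp : ∀ t, 0 ≤ p t) (hq : ∀ t, 0 ≤ q t)
    (f g h : E → ℝ) (hh : ∀ t, 0 < h t) :
    ((∀ x y, 0 ≤ (f x - f y) * (g x - g y)) →
      A (fun t => p t * f t * g t * h t) * B q +
        A (fun t => p t * f t * g t) * B (fun t => q t * h t) +
        A (fun t => p t * h t) * B (fun t => q t * f t * g t) +
        A p * B (fun t => q t * f t * g t * h t) ≥
      A (fun t => p t * f t * h t) * B (fun t => q t * g t) +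
        A (fun t => p t * f t) * B (fun t => q t * g t * h t) +
        A (fun t => p t * g t * h t) * B (fun t => q t * f t) +
        A (fun t => p t * g t) * B (fun t => q t * f t * h t)) ∧
    ((∀ x y, (f x - f y) * (g x - g y) ≤ 0) →
      A (fun t => p t * f t * g t * h t) * B q +
        A (fun t => p t * f t * g t) * B (fun t => q t * h t) +
        A (fun t => p t * h t) * B (fun t => q t * f t * g t) +
        A p * B (fun t => q t * f t * g t * h t) ≤
      A (fun t => p t * f t * h t) * B (fun t => q t * g t) +
        A (fun t => p t * f t) * B (fun t => q t * g t * h t) +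
        A (fun t => p t * g t * h t) * B (fun t => q t * f t) +
        A (fun t => p t * g t) * B (fun t => q t * f t * h t)) := by
  have hh' : ∀ t, 0 ≤ h t := fun t => (hh t).le
  refine ⟨fun hfg => ?_, fun hfg => ?_⟩
  · exact chebyshev_of_similarlyOrdered (linearMapOfCombination A hAlin)
      (linearMapOfCombination B hBlin) hAmono hBmono p q hp hq f g h hh' hfg
  · have key := chebyshev_of_similarlyOrdered (linearMapOfCombination A hAlin)
      (linearMapOfCombination B hBlin) hAmono hBmono p q hp hq f (-g) h hh' fun x y => by
        have := hfg x y
        simp only [Pi.neg_apply]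
        linarith
    simp only [mul_neg, neg_mul, map_neg] at key
    have key' := neg_le_neg key
    simp only [neg_add, neg_neg] at key'
    exact key'
end

section
/- Let E be a nonempty set and let A : (E → ℝ) → ℝ be an isotonic linear functional. Let p : E → ℝ be a non-negative function, let f, g : E → ℝ be similarly ordered functions, and let h : E → ℝ be a function with h(t) > 0 for all t ∈ E. Then A(p·f·g·h)·A(p) + A(p·f·g)·A(p·h) ≥ A(p·f·h)·A(p·g) + A(p·f)·A(p·g·h). -/
theorem map_finset_sum_of_map_linear_comb {E ι : Type*} {A : (E → ℝ) → ℝ}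
    (hA : ∀ (f g : E → ℝ) (a b : ℝ), A (fun t => a * f t + b * g t) = a * A f + b * A g)
    (s : Finset ι) (c : ι → ℝ) (u : ι → E → ℝ) :
    A (fun t => ∑ i ∈ s, c i * u i t) = ∑ i ∈ s, c i * A (u i) := by
  classical
  induction s using Finset.induction_on with
  | empty => simpa using hA 0 0 0 0
  | insert i s hi ih =>
    have := hA (u i) (fun t => ∑ i ∈ s, c i * u i t) (c i) 1
    simp only [one_mul] at this
    simp only [Finset.sum_insert hi, this, ih]

theorem stmt_14 {E : Type*} [Nonempty E]
    (A : (E → ℝ) → ℝ)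
    (hAlin : ∀ (f g : E → ℝ) (a b : ℝ), A (fun t => a * f t + b * g t) = a * A f + b * A g)
    (hAmono : ∀ f : E → ℝ, (∀ t, (0:ℝ) ≤ f t) → 0 ≤ A f)
    (p : E → ℝ) (hp : ∀ t, 0 ≤ p t)
    (f g h : E → ℝ) (hfg : ∀ x y, 0 ≤ (f x - f y) * (g x - g y)) (hh : ∀ t, 0 < h t) :
    A (fun t => p t * f t * g t * h t) * A p +
      A (fun t => p t * f t * g t) * A (fun t => p t * h t) ≥
    A (fun t => p t * f t * h t) * A (fun t => p t * g t) +
      A (fun t => p t * f t) * A (fun t => p t * g t * h t) := by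
  have sum8 := fun c u => map_finset_sum_of_map_linear_comb hAlin (Finset.univ : Finset (Fin 8)) c u
  have inner (y : E) := hAmono
    (fun x => p x * ((h x + h y) * ((f x - f y) * (g x - g y)))) fun x =>
      mul_nonneg (hp x) (mul_nonneg (add_pos (hh x) (hh y)).le (hfg x y))
  have inner_eq (y : E) := sum8
    ![1, -g y, -f y, f y * g y, h y, -(h y * g y), -(h y * f y), h y * f y * g y]
    ![fun t => p t * f t * g t * h t, fun t => p t * f t * h t, fun t => p t * g t * h t,
      fun t => p t * h t, fun t => p t * f t * g t, fun t => p t * f t, fun t => p t * g t, p]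
  have outer_eq := sum8
    ![A (fun t => p t * f t * g t * h t), -A (fun t => p t * f t * h t),
      -A (fun t => p t * g t * h t), A (fun t => p t * h t), A (fun t => p t * f t * g t),
      -A (fun t => p t * f t), -A (fun t => p t * g t), A p]
    ![p, fun t => p t * g t, fun t => p t * f t, fun t => p t * f t * g t, fun t => p t * h t,
      fun t => p t * g t * h t, fun t => p t * f t * h t, fun t => p t * f t * g t * h t]
  have outer := hAmono _ fun y => mul_nonneg (hp y) (inner y)
  simp only [Fin.sum_univ_eight, Matrix.cons_val] at inner_eq outer_eq
  have key : (fun y => p y * A (fun x => p x * ((h x + h y) * ((f x - f y) * (g x - g y))))) =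
      fun t => A (fun t => p t * f t * g t * h t) * p t
        + -A (fun t => p t * f t * h t) * (p t * g t)
        + -A (fun t => p t * g t * h t) * (p t * f t)
        + A (fun t => p t * h t) * (p t * f t * g t)
        + A (fun t => p t * f t * g t) * (p t * h t)
        + -A (fun t => p t * f t) * (p t * g t * h t)
        + -A (fun t => p t * g t) * (p t * f t * h t)
        + A p * (p t * f t * g t * h t) := by
    funext y
    have expand := inner_eq y
    rw [show A (fun x => p x * ((h x + h y) * ((f x - f y) * (g x - g y)))) = _ from
      (congrArg A (funext fun x => by ring)).trans expand]
    ring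
  rw [key, outer_eq] at outer
  linarith
end

section
/- Let E be a nonempty set and let A, B : (E → ℝ) → ℝ be isotonic linear functionals. Let p, q : E → ℝ be functions and let f, g, h : E → ℝ be functions. Define H_{f,g,h}(x,y) = (f(x)−f(y))·(g(x)−g(y))·(h(x)−h(y)). Then B(y ↦ A(x ↦ p(x)·q(y)·H_{f,g,h}(x,y))) = A(p·f·g·h)·B(q) + A(p·f)·B(q·g·h) + A(p·g)·B(q·f·h) + A(p·h)·B(q·f·g) − A(p·g·h)·B(q·f) − A(p·f·h)·B(q·g) − A(p·f·g)·B(q·h) − A(p)·B(q·f·g·h). -/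
/-- A functional preserving binary linear combinations preserves finite linear combinations. -/
theorem map_sum_of_map_lin_comb {E ι : Type*} {A : (E → ℝ) → ℝ}
    (hA : ∀ (f g : E → ℝ) (a b : ℝ), A (fun t => a * f t + b * g t) = a * A f + b * A g)
    (s : Finset ι) (c : ι → ℝ) (F : ι → E → ℝ) :
    A (fun t => ∑ i ∈ s, c i * F i t) = ∑ i ∈ s, c i * A (F i) := by
  classical
  induction s using Finset.induction_on with
  | empty => simpa using hA 0 0 0 0
  | insert i s hi ih =>
    simp only [Finset.sum_insert hi]
    simpa [ih] using hA (F i) (fun t => ∑ j ∈ s, c j * F j t) (c i) 1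

theorem stmt_15 {E : Type*} [Nonempty E]
    (A B : (E → ℝ) → ℝ)
    (hAlin : ∀ (f g : E → ℝ) (a b : ℝ), A (fun t => a * f t + b * g t) = a * A f + b * A g)
    (hAmono : ∀ f : E → ℝ, (∀ t, (0:ℝ) ≤ f t) → 0 ≤ A f)
    (hBlin : ∀ (f g : E → ℝ) (a b : ℝ), B (fun t => a * f t + b * g t) = a * B f + b * B g)
    (hBmono : ∀ f : E → ℝ, (∀ t, (0:ℝ) ≤ f t) → 0 ≤ B f)
    (p q f g h : E → ℝ) :
    B (fun y => A (fun x => p x * q y *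
        ((f x - f y) * (g x - g y) * (h x - h y)))) =
      A (fun t => p t * f t * g t * h t) * B q +
        A (fun t => p t * f t) * B (fun t => q t * g t * h t) +
        A (fun t => p t * g t) * B (fun t => q t * f t * h t) +
        A (fun t => p t * h t) * B (fun t => q t * f t * g t) -
        A (fun t => p t * g t * h t) * B (fun t => q t * f t) -
        A (fun t => p t * f t * h t) * B (fun t => q t * g t) -
        A (fun t => p t * f t * g t) * B (fun t => q t * h t) -
        A p * B (fun t => q t * f t * g t * h t) := by
  have inner_eq (y : E) : A (fun x => p x * q y * ((f x - f y) * (g x - g y) * (h x - h y))) =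
      A (fun t => p t * f t * g t * h t) * q y +
        A (fun t => p t * f t) * (q y * g y * h y) +
        A (fun t => p t * g t) * (q y * f y * h y) +
        A (fun t => p t * h t) * (q y * f y * g y) -
        A (fun t => p t * g t * h t) * (q y * f y) -
        A (fun t => p t * f t * h t) * (q y * g y) -
        A (fun t => p t * f t * g t) * (q y * h y) -
        A p * (q y * f y * g y * h y) := by
    have key := map_sum_of_map_lin_comb hAlin Finset.univ
      ![q y, q y * g y * h y, q y * f y * h y, q y * f y * g y,
        -(q y * f y), -(q y * g y), -(q y * h y), -(q y * f y * g y * h y)]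
      ![fun t => p t * f t * g t * h t, fun t => p t * f t, fun t => p t * g t,
        fun t => p t * h t, fun t => p t * g t * h t, fun t => p t * f t * h t,
        fun t => p t * f t * g t, p]
    simp [Fin.sum_univ_succ] at key
    convert key using 1
    · congr 1
      funext x
      ring
    · ring
  have key := map_sum_of_map_lin_comb hBlin Finset.univ
    ![A (fun t => p t * f t * g t * h t), A (fun t => p t * f t), A (fun t => p t * g t),
      A (fun t => p t * h t), -A (fun t => p t * g t * h t), -A (fun t => p t * f t * h t),
      -A (fun t => p t * f t * g t), -A p]
    ![q, fun t => q t * g t * h t, fun t => q t * f t * h t, fun t => q t * f t * g t,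
      fun t => q t * f t, fun t => q t * g t, fun t => q t * h t,
      fun t => q t * f t * g t * h t]
  simp [Fin.sum_univ_succ] at key
  simp only [inner_eq]
  convert key using 1
  · congr 1
    funext y
    ring
  · ring
end
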